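/- Let d ≥ 2, p ∈ [1, ∞), and let F ∈ ℝ^{d×d} be a symmetric matrix such that F ≠ a⊙b for all a, b ∈ ℝ^d. Then there exists a constant c > 0 such that for every Lipschitz map ψ : ℝ^d → ℝ^d vanishing outside the open unit ball B₁, the average ⨍_{B₁} dist(𝓔ψ(x), {−F, F})^p dx ≥ c. In particular, the symmetric-quasiconvex envelope of h(A) := dist(A, {−F, F})^p is strictly positive at 0 (while it vanishes at ±F), so this envelope is not convex. -/

import Mathlib

open MeasureTheory

/-- The symmetrized gradient `𝓔ψ(x) = (Dψ(x) + Dψ(x)ᵀ)/2` (via `fderiv`; a.e. defined for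
Lipschitz maps by Rademacher's theorem). -/
noncomputable def symGradE {d : ℕ} (u : EuclideanSpace ℝ (Fin d) → EuclideanSpace ℝ (Fin d))
    (x : EuclideanSpace ℝ (Fin d)) : Matrix (Fin d) (Fin d) ℝ :=
  fun i j =>
    (fderiv ℝ u x (EuclideanSpace.single j 1) i + fderiv ℝ u x (EuclideanSpace.single i 1) j) / 2

/-- The Frobenius norm of a real matrix. -/
noncomputable def frob {d : ℕ} (M : Matrix (Fin d) (Fin d) ℝ) : ℝ :=
  Real.sqrt (∑ i, ∑ j, (M i j) ^ 2)

/-- The symmetric tensor product `a ⊙ b := (a ⊗ b + b ⊗ a)/2`. -/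
noncomputable def symTensor {d : ℕ} (a b : Fin d → ℝ) : Matrix (Fin d) (Fin d) ℝ :=
  fun i j => (a i * b j + b i * a j) / 2

/-- The five-point Laplacian on `ℤ × ℤ`. -/
def latticeLaplacian (v : ℤ × ℤ → ℝ) (x : ℤ × ℤ) : ℝ :=
  v (x + (1, 0)) + v (x + (-1, 0)) + v (x + (0, 1)) + v (x + (0, -1)) - 4 * v x

/-- The discrete half-parabola `n (n - 1) / 2`, extended by zero to the left. -/
noncomputable def halfParabola (n : ℤ) : ℝ := if n ≤ 0 then 0 else (n : ℝ) * (n - 1) / 2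

lemma halfParabola_nonneg (n : ℤ) : 0 ≤ halfParabola n := by
  unfold halfParabola
  split_ifs with h
  · exact le_rfl
  · have : (1 : ℝ) ≤ n := by exact_mod_cast (by omega : 1 ≤ n)
    have : 0 ≤ (n : ℝ) * (n - 1) := mul_nonneg (by linarith) (by linarith)
    linarith

lemma halfParabola_secondDiff_le (n : ℤ) :
    halfParabola (n + 1) + halfParabola (n - 1) - 2 * halfParabola n ≤ 1 := by
  rcases lt_trichotomy n 0 with h | rfl | h
  · simp [halfParabola, show n + 1 ≤ 0 by omega, show n ≤ 1 by omega, show n ≤ 0 by omega]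
  · simp [halfParabola]
  · rcases eq_or_lt_of_le (show 1 ≤ n by omega) with rfl | h1
    · norm_num [halfParabola]
    · rw [halfParabola, halfParabola, halfParabola, if_neg (by omega), if_neg (by omega),
        if_neg (by omega)]
      push_cast
      nlinarith

/-- A compactly supported one-dimensional bump with second difference at most `1` everywhere and
very negative at the origin. -/
noncomputable def tentParabola (R k : ℤ) : ℝ := halfParabola (R - |k|)

lemma tentParabola_secondDiff_le (R k : ℤ) (hR : 1 ≤ R) :
    tentParabola R (k + 1) + tentParabola R (k - 1) - 2 * tentParabola R k ≤ 1 := by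
  unfold tentParabola
  rcases lt_trichotomy k 0 with h | rfl | h
  · have h1 : R - |k + 1| = R - |k| + 1 := by
      rw [abs_of_neg h, abs_of_nonpos (by omega)]; ring
    have h2 : R - |k - 1| = R - |k| - 1 := by
      rw [abs_of_neg h, abs_of_nonpos (by omega)]; ring
    rw [h1, h2]
    exact halfParabola_secondDiff_le _
  · have h0 : (1 : ℝ) ≤ R := by exact_mod_cast hR
    rcases eq_or_lt_of_le hR with rfl | h1
    · norm_num [halfParabola]
    · simp only [zero_add, zero_sub, abs_neg, abs_one, abs_zero, sub_zero]
      rw [halfParabola, halfParabola, if_neg (by omega), if_neg (by omega)]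
      push_cast
      nlinarith
  · have h1 : R - |k + 1| = R - |k| - 1 := by
      rw [abs_of_pos h, abs_of_nonneg (by omega)]; ring
    have h2 : R - |k - 1| = R - |k| + 1 := by
      rw [abs_of_pos h, abs_of_nonneg (by omega)]; ring
    rw [h1, h2]
    have := halfParabola_secondDiff_le (R - |k|)
    linarith

lemma tentParabola_secondDiff_zero (R : ℤ) (hR : 1 < R) :
    tentParabola R 1 + tentParabola R (-1) - 2 * tentParabola R 0 = -2 * (R - 1) := by
  simp only [tentParabola, abs_neg, abs_one, abs_zero, sub_zero]
  rw [halfParabola, halfParabola, if_neg (by omega), if_neg (by omega)]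
  push_cast
  ring

lemma exists_barrier (K : ℕ) (M : ℝ) :
    ∃ W : ℤ → ℝ, (∀ k, 0 ≤ W k) ∧ (∀ k, W (k + 1) + W (k - 1) - 2 * W k ≤ 1) ∧
      (∀ k : ℤ, |k| ≤ K → W (k + 1) + W (k - 1) - 2 * W k ≤ -M) ∧
      ∃ L : ℤ, ∀ k, L < |k| → W k = 0 := by
  obtain ⟨n, hn⟩ := exists_nat_gt ((2 * K + 1) * |M| + 2 * K)
  set R : ℤ := n + 2
  set I : Finset ℤ := Finset.Icc (-(K : ℤ)) K
  have hcard : (I.card : ℝ) = 2 * K + 1 := by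
    simp only [I, Int.card_Icc]
    rw [show ((K : ℤ) + 1 - -K).toNat = 2 * K + 1 by omega]
    push_cast; ring
  have hpos : (0 : ℝ) < 2 * K + 1 := by positivity
  have hdiff : ∀ k, (∑ i ∈ I, tentParabola R (k + 1 - i)) / (2 * K + 1)
      + (∑ i ∈ I, tentParabola R (k - 1 - i)) / (2 * K + 1)
      - 2 * ((∑ i ∈ I, tentParabola R (k - i)) / (2 * K + 1))
      = (∑ i ∈ I, (tentParabola R (k - i + 1) + tentParabola R (k - i - 1)
        - 2 * tentParabola R (k - i))) / (2 * K + 1) := by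
    intro k
    rw [Finset.sum_sub_distrib, Finset.sum_add_distrib, ← Finset.mul_sum]
    simp only [show ∀ i, k + 1 - i = k - i + 1 from fun i => by ring,
      show ∀ i, k - 1 - i = k - i - 1 from fun i => by ring]
    ring
  refine ⟨fun k => (∑ i ∈ I, tentParabola R (k - i)) / (2 * K + 1), ?_, ?_, ?_, ?_⟩
  · intro k
    exact div_nonneg (Finset.sum_nonneg fun i _ => halfParabola_nonneg _) hpos.le
  · intro k
    simp only [hdiff]
    rw [div_le_one hpos, ← hcard]
    refine (Finset.sum_le_card_nsmul I _ 1 fun i _ =>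
      tentParabola_secondDiff_le R _ (by omega)).trans ?_
    simp
  · intro k hk
    simp only [hdiff]
    have hkI : k ∈ I := by
      simp only [I, Finset.mem_Icc]; exact abs_le.1 hk
    rw [div_le_iff₀ hpos, ← Finset.add_sum_erase I _ hkI]
    have h1 : ∑ i ∈ I.erase k, (tentParabola R (k - i + 1) + tentParabola R (k - i - 1)
        - 2 * tentParabola R (k - i)) ≤ 2 * K := by
      refine (Finset.sum_le_card_nsmul _ _ 1 fun i _ =>
        tentParabola_secondDiff_le R _ (by omega)).trans ?_
      rw [Finset.card_erase_of_mem hkI]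
      have : I.card = 2 * K + 1 := by exact_mod_cast hcard
      simp [this]
    have h2 := tentParabola_secondDiff_zero R (by omega)
    simp only [sub_self, zero_add, zero_sub]
    rw [h2]
    simp only [R]
    push_cast
    have h3 : (2 * K + 1) * M ≤ (2 * K + 1) * |M| :=
      mul_le_mul_of_nonneg_left (le_abs_self M) hpos.le
    have h4 : 0 ≤ (2 * (K : ℝ) + 1) * |M| := by positivity
    have h5 : (0 : ℝ) ≤ K := by positivity
    linarith
  · refine ⟨R + K, fun k hk => ?_⟩
    have : ∑ i ∈ I, tentParabola R (k - i) = 0 := by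
      refine Finset.sum_eq_zero fun i hi => ?_
      simp only [I, Finset.mem_Icc] at hi
      have := abs_le.2 hi
      have := abs_sub_abs_le_abs_sub k i
      rw [tentParabola, halfParabola, if_pos (by omega)]
    simp only [this, zero_div]

/-- Solution of the discrete obstacle problem: the mass distribution `ν` can be swept, by a finitely
supported potential `v`, to a distribution between `0` and `1` that saturates where `v > 0`. -/
lemma exists_odometer (ν : ℤ × ℤ → ℝ) (hν : ∀ x, 0 ≤ ν x) (hfin : ν.support.Finite) :
    ∃ v : ℤ × ℤ → ℝ, v.support.Finite ∧ (∀ x, 0 ≤ ν x + latticeLaplacian v x) ∧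
      (∀ x, ν x + latticeLaplacian v x ≤ 1) ∧
      (∀ x, v x ≠ 0 → ν x + latticeLaplacian v x = 1) := by
  classical
  obtain ⟨K, hK⟩ : ∃ K : ℕ, ∀ x, ν x ≠ 0 → |x.1| ≤ K ∧ |x.2| ≤ K := by
    refine ⟨∑ x ∈ hfin.toFinset, (x.1.natAbs + x.2.natAbs), fun x hx => ?_⟩
    have : x.1.natAbs + x.2.natAbs ≤ ∑ x ∈ hfin.toFinset, (x.1.natAbs + x.2.natAbs) :=
      Finset.single_le_sum (f := fun x : ℤ × ℤ => x.1.natAbs + x.2.natAbs)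
        (fun _ _ => Nat.zero_le _) (hfin.mem_toFinset.2 hx)
    rw [Int.abs_eq_natAbs, Int.abs_eq_natAbs]
    omega
  obtain ⟨M, hM⟩ : ∃ M : ℝ, ∀ x, ν x ≤ M :=
    ⟨∑ x ∈ hfin.toFinset, ν x, fun x => by
      by_cases hx : ν x = 0
      · rw [hx]; exact Finset.sum_nonneg fun i _ => hν i
      · exact Finset.single_le_sum (f := ν) (fun i _ => hν i) (hfin.mem_toFinset.2 hx)⟩
  obtain ⟨W, hW0, hW1, hWM, L, hL⟩ := exists_barrier K M
  set A : Set (ℤ × ℤ → ℝ) :=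
    {w | (∀ x, 0 ≤ w x) ∧ ∀ x, ν x + latticeLaplacian w x ≤ 1} with hA
  have hB : ∀ k : ℤ, ∀ x, (ν x ≠ 0 → |k| ≤ K) → ν x + (W (k + 1) + W (k - 1) - 2 * W k) ≤ 1 := by
    intro k x h
    by_cases hx : ν x = 0
    · rw [hx, zero_add]; exact hW1 k
    · linarith [hWM k (h hx), hM x]
  have hA1 : (fun x : ℤ × ℤ => W x.1) ∈ A := by
    refine ⟨fun x => hW0 _, fun x => ?_⟩
    have := hB x.1 x fun h => (hK x h).1
    simp only [latticeLaplacian, Prod.fst_add, add_zero, ← sub_eq_add_neg]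
    linarith
  have hA2 : (fun x : ℤ × ℤ => W x.2) ∈ A := by
    refine ⟨fun x => hW0 _, fun x => ?_⟩
    have := hB x.2 x fun h => (hK x h).2
    simp only [latticeLaplacian, Prod.snd_add, add_zero, ← sub_eq_add_neg]
    linarith
  have : Nonempty A := ⟨⟨_, hA1⟩⟩
  have hbdd : ∀ x, BddBelow (Set.range fun w : A => w.1 x) := fun x =>
    ⟨0, by rintro _ ⟨w, rfl⟩; exact w.2.1 x⟩
  set v : ℤ × ℤ → ℝ := fun x => ⨅ w : A, w.1 x with hv
  have hvle : ∀ w ∈ A, ∀ x, v x ≤ w x := fun w hw x => ciInf_le (hbdd x) ⟨w, hw⟩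
  have hv0 : ∀ x, 0 ≤ v x := fun x => le_ciInf fun w => w.2.1 x
  have hv1 : ∀ x, ν x + latticeLaplacian v x ≤ 1 := by
    intro x
    have : (ν x + v (x + (1, 0)) + v (x + (-1, 0)) + v (x + (0, 1)) + v (x + (0, -1)) - 1) / 4
        ≤ v x := by
      refine le_ciInf fun w => ?_
      have h := w.2.2 x
      have := hvle _ w.2
      simp only [latticeLaplacian] at h
      linarith [this (x + (1, 0)), this (x + (-1, 0)), this (x + (0, 1)), this (x + (0, -1))]
    simp only [latticeLaplacian]
    linarith
  have hveq : ∀ x, v x ≠ 0 → ν x + latticeLaplacian v x = 1 := by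
    intro x hx
    by_contra hne
    have hlt : ν x + latticeLaplacian v x < 1 := lt_of_le_of_ne (hv1 x) hne
    have hpos : 0 < v x := lt_of_le_of_ne (hv0 x) (Ne.symm hx)
    obtain ⟨ε, hε, hε1, hε2⟩ : ∃ ε > 0, ε ≤ v x ∧
        4 * ε ≤ 1 - (ν x + latticeLaplacian v x) :=
      ⟨min (v x) ((1 - (ν x + latticeLaplacian v x)) / 4), lt_min hpos (by linarith),
        min_le_left _ _, by linarith [min_le_right (v x) ((1 - (ν x + latticeLaplacian v x)) / 4)]⟩
    have hmem : Function.update v x (v x - ε) ∈ A := by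
      have hle : ∀ y, Function.update v x (v x - ε) y ≤ v y := by
        intro y
        by_cases hy : y = x
        · subst hy; simp [hε.le]
        · simp [hy]
      refine ⟨fun y => ?_, fun y => ?_⟩
      · by_cases hy : y = x
        · subst hy; simpa using hε1
        · simpa [hy] using hv0 y
      · have h1 := hle (y + (1, 0))
        have h2 := hle (y + (-1, 0))
        have h3 := hle (y + (0, 1))
        have h4 := hle (y + (0, -1))
        by_cases hy : y = x
        · subst hy
          simp only [latticeLaplacian, Function.update_self] at *
          linarith
        · have := hv1 y
          simp only [latticeLaplacian, Function.update_of_ne hy] at *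
          linarith
    have := hvle _ hmem x
    simp at this
    linarith
  refine ⟨v, ?_, fun x => ?_, hv1, hveq⟩
  · refine ((Set.finite_Icc (-L) L).prod (Set.finite_Icc (-L) L)).subset fun x hx => ?_
    have h1 : ¬ L < |x.1| := fun h =>
      hx (le_antisymm ((hvle _ hA1 x).trans_eq (hL _ h)) (hv0 x))
    have h2 : ¬ L < |x.2| := fun h =>
      hx (le_antisymm ((hvle _ hA2 x).trans_eq (hL _ h)) (hv0 x))
    exact ⟨abs_le.1 (not_lt.1 h1), abs_le.1 (not_lt.1 h2)⟩
  · by_cases hx : v x = 0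
    · have := hν x
      simp only [latticeLaplacian, hx]
      linarith [hv0 (x + (1, 0)), hv0 (x + (-1, 0)), hv0 (x + (0, 1)), hv0 (x + (0, -1))]
    · rw [hveq x hx]; exact zero_le_one

lemma summable_of_support_finite {q : ℤ × ℤ → ℝ} (hq : q.support.Finite) : Summable q :=
  summable_of_hasFiniteSupport hq

lemma hasSum_shift_sub {q : ℤ × ℤ → ℝ} (hq : q.support.Finite) (s : ℤ × ℤ) :
    HasSum (fun x => q (x + s) - q x) 0 := by
  have h := (summable_of_support_finite hq).hasSum
  have h' : HasSum (fun x => q (x + s)) (∑' x, q x) := (Equiv.addRight s).hasSum_iff.2 h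
  simpa using h'.sub h

lemma hasSum_latticeLaplacian {v : ℤ × ℤ → ℝ} (hv : v.support.Finite) :
    HasSum (latticeLaplacian v) 0 := by
  have h := (((hasSum_shift_sub hv (1, 0)).add (hasSum_shift_sub hv (-1, 0))).add
    (hasSum_shift_sub hv (0, 1))).add (hasSum_shift_sub hv (0, -1))
  simp only [add_zero] at h
  convert h using 2 with x
  simp only [latticeLaplacian]
  ring

/-- The discrete divergence of `(u₁, u₂)`, by forward differences. -/
def latticeDiv (u₁ u₂ : ℤ × ℤ → ℝ) (x : ℤ × ℤ) : ℝ :=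
  (u₁ (x + (1, 0)) - u₁ x) + (u₂ (x + (0, 1)) - u₂ x)

/-- The discrete analogue of `∂₁u₁ - ∂₂u₂`, by forward differences. -/
def latticeShear (u₁ u₂ : ℤ × ℤ → ℝ) (x : ℤ × ℤ) : ℝ :=
  (u₁ (x + (1, 0)) - u₁ x) - (u₂ (x + (0, 1)) - u₂ x)

/-- The discrete analogue of `∂₂u₁ + ∂₁u₂`, by backward differences. -/
def latticeTwist (u₁ u₂ : ℤ × ℤ → ℝ) (x : ℤ × ℤ) : ℝ :=
  (u₁ x - u₁ (x + (0, -1))) + (u₂ x - u₂ (x + (-1, 0)))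

/-- The discrete analogue of `∂₂u₁ - ∂₁u₂`, by backward differences. -/
def latticeCurl (u₁ u₂ : ℤ × ℤ → ℝ) (x : ℤ × ℤ) : ℝ :=
  (u₁ x - u₁ (x + (0, -1))) - (u₂ x - u₂ (x + (-1, 0)))

lemma hasSum_energy_identity {u₁ u₂ : ℤ × ℤ → ℝ} (h₁ : u₁.support.Finite) :
    HasSum (fun x => latticeDiv u₁ u₂ x ^ 2 + latticeCurl u₁ u₂ x ^ 2
      - latticeShear u₁ u₂ x ^ 2 - latticeTwist u₁ u₂ x ^ 2) 0 := by
  have hf : ∀ s t : ℤ × ℤ, (fun x => u₁ (x + s) * u₂ (x + t)).support.Finite := fun s t =>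
    (h₁.preimage (add_left_injective s).injOn).subset fun x hx => left_ne_zero_of_mul hx
  have h := (((hasSum_shift_sub (hf (0, -1) (-1, 0)) (1, 1)).mul_left 4).sub
    ((hasSum_shift_sub (hf 0 (-1, 0)) (1, 0)).mul_left 4)).sub
    ((hasSum_shift_sub (hf (0, -1) 0) (0, 1)).mul_left 4)
  simp only [mul_zero, sub_zero] at h
  refine (congrArg (HasSum · 0) (funext fun x => ?_)).mpr h
  simp only [latticeDiv, latticeCurl, latticeShear, latticeTwist, add_assoc, Prod.mk_add_mk,
    add_zero, Int.reduceAdd, Int.reduceNeg, ← Prod.zero_eq_mk]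
  ring

lemma one_le_sq_add_abs_sub_two (r : ℝ) : 1 ≤ r ^ 2 + |r - 2| := by
  nlinarith [neg_abs_le (r - 2), sq_nonneg (r - 1 / 2)]

/-- Weak-type inequality for the discrete Cauchy–Riemann system: if the shear and the twist of
`(u₁, u₂)` are summably small, the divergence cannot stay away from zero on a large set. -/
lemma tsum_indicator_le {u₁ u₂ : ℤ × ℤ → ℝ} (h₁ : u₁.support.Finite) (h₂ : u₂.support.Finite)
    {S : Set (ℤ × ℤ)} (hS : S.Finite) :
    ∑' x, S.indicator 1 x ≤ ∑' x, (7 * (|latticeShear u₁ u₂ x| + |latticeTwist u₁ u₂ x|)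
      + S.indicator (fun x => |(|latticeDiv u₁ u₂ x| - 2)|) x) := by
  have hshift : ∀ {u : ℤ × ℤ → ℝ} (_ : u.support.Finite) (s : ℤ × ℤ),
      (fun x => u (x + s)).support.Finite := fun h s => h.preimage (add_left_injective s).injOn
  have hadd : ∀ {u w : ℤ × ℤ → ℝ} (_ : u.support.Finite) (_ : w.support.Finite),
      (fun x => u x + w x).support.Finite := fun h h' =>
    (h.union h').subset (Function.support_add _ _)
  have hsub : ∀ {u w : ℤ × ℤ → ℝ} (_ : u.support.Finite) (_ : w.support.Finite),
      (fun x => u x - w x).support.Finite := fun h h' =>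
    (h.union h').subset (Function.support_sub _ _)
  set g₁ := latticeShear u₁ u₂ with hg₁
  set g₂ := latticeTwist u₁ u₂ with hg₂
  have hgf₁ : g₁.support.Finite := hsub (hsub (hshift h₁ _) h₁) (hsub (hshift h₂ _) h₂)
  have hgf₂ : g₂.support.Finite := hadd (hsub h₁ (hshift h₁ _)) (hsub h₂ (hshift h₂ _))
  have hpos : ∀ {g : ℤ × ℤ → ℝ} (_ : g.support.Finite),
      (fun x => max (g x) 0).support.Finite := fun h => h.subset fun x hx hgx => by
    simp only [Function.mem_support] at hx; simp [hgx] at hx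
  have hneg : ∀ {g : ℤ × ℤ → ℝ} (_ : g.support.Finite),
      (fun x => max (-g x) 0).support.Finite := fun h => h.subset fun x hx hgx => by
    simp only [Function.mem_support] at hx; simp [hgx] at hx
  obtain ⟨a, haf, ha0, ha1, hae⟩ :=
    exists_odometer _ (fun x => le_max_right (g₁ x) 0) (hpos hgf₁)
  obtain ⟨b, hbf, hb0, hb1, hbe⟩ :=
    exists_odometer _ (fun x => le_max_right (-g₁ x) 0) (hneg hgf₁)
  obtain ⟨c, hcf, hc0, hc1, hce⟩ :=
    exists_odometer _ (fun x => le_max_right (g₂ x) 0) (hpos hgf₂)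
  obtain ⟨e, hef, he0, he1, hee⟩ :=
    exists_odometer _ (fun x => le_max_right (-g₂ x) 0) (hneg hgf₂)
  set m := ∑' x, (|g₁ x| + |g₂ x|) with hm
  have hmf : (fun x => |g₁ x| + |g₂ x|).support.Finite :=
    hadd (hgf₁.subset fun x hx h => hx (by simp [h])) (hgf₂.subset fun x hx h => hx (by simp [h]))
  have hmS : HasSum (fun x => |g₁ x| + |g₂ x|) m := (summable_of_support_finite hmf).hasSum
  set T : ℤ × ℤ → ℝ := fun x => (max (g₁ x) 0 + latticeLaplacian a x)
    + (max (-g₁ x) 0 + latticeLaplacian b x) + (max (g₂ x) 0 + latticeLaplacian c x)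
    + (max (-g₂ x) 0 + latticeLaplacian e x) with hT
  have hTS : HasSum T m := by
    have h := (((hmS.add (hasSum_latticeLaplacian haf)).add (hasSum_latticeLaplacian hbf)).add
      (hasSum_latticeLaplacian hcf)).add (hasSum_latticeLaplacian hef)
    simp only [add_zero] at h
    convert h using 2 with x
    simp only [hT]
    have habs : ∀ r : ℝ, |r| = max r 0 + max (-r) 0 := fun r => by
      rcases le_total 0 r with h | h
      · rw [abs_of_nonneg h, max_eq_left h, max_eq_right (by linarith)]; ring
      · rw [abs_of_nonpos h, max_eq_right h, max_eq_left (by linarith)]; ring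
    rw [habs (g₁ x), habs (g₂ x)]
    ring
  have hT0 : ∀ x, 0 ≤ T x := fun x => by
    simp only [hT]; linarith [ha0 x, hb0 x, hc0 x, he0 x]
  have hT1 : ∀ x, T x < 1 → a x = 0 ∧ b x = 0 ∧ c x = 0 ∧ e x = 0 := fun x hx => by
    simp only [hT] at hx
    refine ⟨?_, ?_, ?_, ?_⟩ <;> by_contra hne
    · linarith [hae x hne, hb0 x, hc0 x, he0 x]
    · linarith [hbe x hne, ha0 x, hc0 x, he0 x]
    · linarith [hce x hne, hb0 x, ha0 x, he0 x]
    · linarith [hee x hne, hb0 x, hc0 x, ha0 x]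
  set U₁ : ℤ × ℤ → ℝ := fun x => u₁ x + ((a x - b x) - (a (x + (-1, 0)) - b (x + (-1, 0))))
    + ((c (x + (0, 1)) - e (x + (0, 1))) - (c x - e x)) with hU₁
  set U₂ : ℤ × ℤ → ℝ := fun x => u₂ x - ((a x - b x) - (a (x + (0, -1)) - b (x + (0, -1))))
    + ((c (x + (1, 0)) - e (x + (1, 0))) - (c x - e x)) with hU₂
  have hUf₁ : U₁.support.Finite :=
    hadd (hadd h₁ (hsub (hsub haf hbf) (hsub (hshift haf _) (hshift hbf _))))
      (hsub (hsub (hshift hcf _) (hshift hef _)) (hsub hcf hef))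
  have hshear : ∀ x, latticeShear U₁ U₂ x = (max (g₁ x) 0 + latticeLaplacian a x)
      - (max (-g₁ x) 0 + latticeLaplacian b x) := by
    intro x
    have : g₁ x = max (g₁ x) 0 - max (-g₁ x) 0 := by
      rcases le_total 0 (g₁ x) with h | h
      · rw [max_eq_left h, max_eq_right (by linarith)]; ring
      · rw [max_eq_right h, max_eq_left (by linarith)]; ring
    calc latticeShear U₁ U₂ x = g₁ x + latticeLaplacian a x - latticeLaplacian b x := by
          simp only [hg₁, hU₁, hU₂, latticeShear, latticeLaplacian, add_assoc, Prod.mk_add_mk,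
            add_zero, zero_add, Int.reduceAdd, Int.reduceNeg, ← Prod.zero_eq_mk]
          ring
      _ = _ := by linarith
  have htwist : ∀ x, latticeTwist U₁ U₂ x = (max (g₂ x) 0 + latticeLaplacian c x)
      - (max (-g₂ x) 0 + latticeLaplacian e x) := by
    intro x
    have : g₂ x = max (g₂ x) 0 - max (-g₂ x) 0 := by
      rcases le_total 0 (g₂ x) with h | h
      · rw [max_eq_left h, max_eq_right (by linarith)]; ring
      · rw [max_eq_right h, max_eq_left (by linarith)]; ring
    calc latticeTwist U₁ U₂ x = g₂ x + latticeLaplacian c x - latticeLaplacian e x := by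
          simp only [hg₂, hU₁, hU₂, latticeTwist, latticeLaplacian, add_assoc, Prod.mk_add_mk,
            add_zero, zero_add, Int.reduceAdd, Int.reduceNeg, ← Prod.zero_eq_mk]
          ring
      _ = _ := by linarith
  have hsq : ∀ x, latticeShear U₁ U₂ x ^ 2 + latticeTwist U₁ U₂ x ^ 2 ≤ T x := by
    have key : ∀ p q : ℝ, 0 ≤ p → p ≤ 1 → 0 ≤ q → q ≤ 1 → (p - q) ^ 2 ≤ p + q := by
      intro p q hp hp1 hq hq1
      nlinarith [mul_nonneg hp hq, mul_nonneg hp (sub_nonneg.2 hp1),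
        mul_nonneg hq (sub_nonneg.2 hq1)]
    intro x
    rw [hshear, htwist]
    simp only [hT]
    linarith [key _ _ (ha0 x) (ha1 x) (hb0 x) (hb1 x), key _ _ (hc0 x) (hc1 x) (he0 x) (he1 x)]
  have hTshift : ∀ s, HasSum (fun x => T (x + s)) m := fun s =>
    (Equiv.addRight s).hasSum_iff.2 hTS
  have hind : Summable fun x => S.indicator (fun x => |(|latticeDiv u₁ u₂ x| - 2)|) x :=
    summable_of_support_finite (hS.subset Set.support_indicator_subset)
  have hone : Summable fun x => S.indicator (1 : ℤ × ℤ → ℝ) x :=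
    summable_of_support_finite (hS.subset Set.support_indicator_subset)
  have hpt : ∀ x, S.indicator (1 : ℤ × ℤ → ℝ) x ≤
      (T x + T (x + (1, 0)) + T (x + (-1, 0)) + T (x + (0, 1)) + T (x + (0, -1))
        + T (x + (1, 1))) + T x + (latticeDiv U₁ U₂ x ^ 2 + latticeCurl U₁ U₂ x ^ 2
      - latticeShear U₁ U₂ x ^ 2 - latticeTwist U₁ U₂ x ^ 2)
        + S.indicator (fun x => |(|latticeDiv u₁ u₂ x| - 2)|) x := by
    intro x
    have hs := hsq x
    have hc := sq_nonneg (latticeCurl U₁ U₂ x)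
    have hd := sq_nonneg (latticeDiv U₁ U₂ x)
    have t0 := hT0 x
    have t1 := hT0 (x + (1, 0))
    have t2 := hT0 (x + (-1, 0))
    have t3 := hT0 (x + (0, 1))
    have t4 := hT0 (x + (0, -1))
    have t5 := hT0 (x + (1, 1))
    by_cases hx : x ∈ S
    · rw [Set.indicator_of_mem hx, Set.indicator_of_mem hx, Pi.one_apply]
      have hr := abs_nonneg (|latticeDiv u₁ u₂ x| - 2)
      by_cases hbad : 1 ≤ T x + T (x + (1, 0)) + T (x + (-1, 0)) + T (x + (0, 1))
          + T (x + (0, -1)) + T (x + (1, 1))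
      · linarith
      · rw [not_le] at hbad
        obtain ⟨z1, z2, z3, z4⟩ := hT1 x (by linarith)
        obtain ⟨z5, z6, z7, z8⟩ := hT1 (x + (1, 0)) (by linarith)
        obtain ⟨y1, y2, -, -⟩ := hT1 (x + (-1, 0)) (by linarith)
        obtain ⟨y5, y6, y7, y8⟩ := hT1 (x + (0, 1)) (by linarith)
        obtain ⟨w1, w2, -, -⟩ := hT1 (x + (0, -1)) (by linarith)
        obtain ⟨-, -, w7, w8⟩ := hT1 (x + (1, 1)) (by linarith)
        have hdiv : latticeDiv U₁ U₂ x = latticeDiv u₁ u₂ x := by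
          simp only [hU₁, hU₂, latticeDiv, add_assoc, Prod.mk_add_mk,
            add_zero, zero_add, Int.reduceAdd, Int.reduceNeg, ← Prod.zero_eq_mk, z1, z2, z3, z4,
            z5, z6, z7, z8, y1, y2, y5, y6, y7, y8, w1, w2, w7, w8]
          ring
        have := one_le_sq_add_abs_sub_two |latticeDiv u₁ u₂ x|
        rw [sq_abs, ← hdiv] at this
        rw [← hdiv]
        linarith
    · rw [Set.indicator_of_notMem hx, Set.indicator_of_notMem hx]
      linarith
  have hsum := (((((((hTS.add (hTshift (1, 0))).add (hTshift (-1, 0))).add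
    (hTshift (0, 1))).add (hTshift (0, -1))).add (hTshift (1, 1))).add hTS).add
    (hasSum_energy_identity (u₂ := U₂) hUf₁)).add hind.hasSum
  refine (hasSum_le hpt hone.hasSum hsum).trans_eq ?_
  rw [(hmS.summable.mul_left 7).tsum_add hind, tsum_mul_left]
  ring

section Unfolding

variable {E : Type*} [NormedAddCommGroup E]

/-- The finite-difference density controlling the volume of the unit ball. -/
noncomputable def diffDensity (u₁ u₂ : E → ℝ) (A₁ A₂ x : E) : ℝ :=
  7 * (|(u₁ (x + A₁) - u₁ x) - (u₂ (x + A₂) - u₂ x)|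
      + |(u₁ x - u₁ (x - A₂)) + (u₂ x - u₂ (x - A₁))|)
    + (Metric.ball (0 : E) 1).indicator
      (fun x => |(|(u₁ (x + A₁) - u₁ x) + (u₂ (x + A₂) - u₂ x)| - 2)|) x

lemma diffDensity_nonneg (u₁ u₂ : E → ℝ) (A₁ A₂ x : E) : 0 ≤ diffDensity u₁ u₂ A₁ A₂ x :=
  add_nonneg (by positivity) (Set.indicator_nonneg (fun _ _ => abs_nonneg _) _)

lemma measurable_diffDensity [MeasurableSpace E] [BorelSpace E] {u₁ u₂ : E → ℝ}
    (hu₁ : Continuous u₁) (hu₂ : Continuous u₂) (A₁ A₂ : E) :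
    Measurable (diffDensity u₁ u₂ A₁ A₂) := by
  unfold diffDensity
  refine Measurable.add ?_ (Measurable.indicator ?_ Metric.isOpen_ball.measurableSet)
  · exact Continuous.measurable (by fun_prop)
  · exact Continuous.measurable (by fun_prop)

variable [NormedSpace ℝ E]

lemma finite_lattice_near {A₁ A₂ : E} {l₁ l₂ : E →L[ℝ] ℝ} (h₁₁ : l₁ A₁ = 1) (h₁₂ : l₁ A₂ = 0)
    (h₂₁ : l₂ A₁ = 0) (h₂₂ : l₂ A₂ = 1) (x : E) :
    {m : ℤ × ℤ | ‖x + ((m.1 : ℝ) • A₁ + (m.2 : ℝ) • A₂)‖ < 1}.Finite := by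
  have key : ∀ (l : E →L[ℝ] ℝ) (k : ℤ) (y : E), ‖y‖ < 1 → l y = l x + k →
      k ∈ Set.Icc (-⌈‖l‖ + |l x|⌉) ⌈‖l‖ + |l x|⌉ := by
    intro l k y hy hl
    have h1 : |l y| ≤ ‖l‖ := by
      simpa using (l.le_opNorm y).trans (mul_le_of_le_one_right (norm_nonneg _) hy.le)
    have h2 := Int.le_ceil (‖l‖ + |l x|)
    obtain ⟨h3, h4⟩ := abs_le.1 h1
    constructor
    · have : ((-⌈‖l‖ + |l x|⌉ : ℤ) : ℝ) ≤ k := by push_cast; linarith [le_abs_self (l x)]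
      exact_mod_cast this
    · have : (k : ℝ) ≤ (⌈‖l‖ + |l x|⌉ : ℤ) := by linarith [neg_abs_le (l x)]
      exact_mod_cast this
  refine ((Set.finite_Icc (-⌈‖l₁‖ + |l₁ x|⌉) ⌈‖l₁‖ + |l₁ x|⌉).prod
    (Set.finite_Icc (-⌈‖l₂‖ + |l₂ x|⌉) ⌈‖l₂‖ + |l₂ x|⌉)).subset fun m hm => ⟨?_, ?_⟩
  · exact key l₁ _ _ hm (by simp [h₁₁, h₁₂])
  · exact key l₂ _ _ hm (by simp [h₂₁, h₂₂])

variable [MeasurableSpace E] [BorelSpace E]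

/-- Unfolding: integrating the periodization of `φ` along the lattice `ℤ A₁ + ℤ A₂` over a
fundamental domain recovers the integral of `φ`. -/
lemma setLIntegral_tsum_lattice (μ : Measure E) [μ.IsAddRightInvariant] {A₁ A₂ : E}
    {l₁ l₂ : E →L[ℝ] ℝ} (h₁₁ : l₁ A₁ = 1) (h₁₂ : l₁ A₂ = 0) (h₂₁ : l₂ A₁ = 0) (h₂₂ : l₂ A₂ = 1)
    {φ : E → ENNReal} (hφ : Measurable φ) :
    ∫⁻ x in {x | l₁ x ∈ Set.Ico 0 1 ∧ l₂ x ∈ Set.Ico 0 1},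
      ∑' m : ℤ × ℤ, φ (x + ((m.1 : ℝ) • A₁ + (m.2 : ℝ) • A₂)) ∂μ = ∫⁻ x, φ x ∂μ := by
  set D : Set E := {x | l₁ x ∈ Set.Ico 0 1 ∧ l₂ x ∈ Set.Ico 0 1} with hD
  set s : ℤ × ℤ → E := fun m => (m.1 : ℝ) • A₁ + (m.2 : ℝ) • A₂ with hs
  have hDm : MeasurableSet D :=
    (l₁.continuous.measurable measurableSet_Ico).inter (l₂.continuous.measurable measurableSet_Ico)
  have hmem : ∀ y m, y - s m ∈ D ↔ m = (⌊l₁ y⌋, ⌊l₂ y⌋) := by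
    intro y m
    rw [Prod.ext_iff, eq_comm (a := m.1), eq_comm (a := m.2), Int.floor_eq_iff, Int.floor_eq_iff]
    simp only [hD, hs, Set.mem_ofPred_eq, Set.mem_Ico, map_sub, map_add, map_smul, h₁₁, h₁₂, h₂₁,
      h₂₂, smul_eq_mul, mul_one, mul_zero, add_zero, zero_add]
    constructor
    · rintro ⟨⟨_, _⟩, _, _⟩; refine ⟨⟨?_, ?_⟩, ?_, ?_⟩ <;> linarith
    · rintro ⟨⟨_, _⟩, _, _⟩; refine ⟨⟨?_, ?_⟩, ?_, ?_⟩ <;> linarith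
  change ∫⁻ x in D, ∑' m, φ (x + s m) ∂μ = _
  rw [lintegral_tsum (f := fun m x => φ (x + s m)) fun m =>
    (hφ.comp (measurable_add_const (s m))).aemeasurable]
  have hterm : ∀ m, ∫⁻ x in D, φ (x + s m) ∂μ
      = ∫⁻ y, ((fun y => y - s m) ⁻¹' D).indicator φ y ∂μ := by
    intro m
    rw [← lintegral_indicator hDm]
    refine Eq.trans (lintegral_congr fun x => ?_) (lintegral_add_right_eq_self
      (fun y => ((fun y => y - s m) ⁻¹' D).indicator φ y) (s m))
    simp [Set.indicator]
  have hvm : ∀ m, MeasurableSet ((fun y => y - s m) ⁻¹' D) := fun m => by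
    have hc : Continuous fun y : E => y - s m := by fun_prop
    exact hc.measurable hDm
  simp only [hterm]
  rw [← lintegral_tsum fun m => (hφ.indicator (hvm m)).aemeasurable]
  refine lintegral_congr fun y => ?_
  rw [tsum_eq_single (⌊l₁ y⌋, ⌊l₂ y⌋)]
  · refine Set.indicator_of_mem ?_ _
    exact (hmem _ _).2 rfl
  · intro m hm
    refine Set.indicator_of_notMem ?_ _
    exact fun h => hm ((hmem _ _).1 h)

lemma measure_ball_le_lintegral (μ : Measure E) [μ.IsAddRightInvariant] {A₁ A₂ : E}
    {l₁ l₂ : E →L[ℝ] ℝ} (h₁₁ : l₁ A₁ = 1) (h₁₂ : l₁ A₂ = 0) (h₂₁ : l₂ A₁ = 0) (h₂₂ : l₂ A₂ = 1)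
    {u₁ u₂ : E → ℝ} (hu₁ : Continuous u₁) (hu₂ : Continuous u₂)
    (hz₁ : ∀ x, 1 ≤ ‖x‖ → u₁ x = 0) (hz₂ : ∀ x, 1 ≤ ‖x‖ → u₂ x = 0) :
    μ (Metric.ball 0 1) ≤ ∫⁻ x, ENNReal.ofReal (diffDensity u₁ u₂ A₁ A₂ x) ∂μ := by
  have hball : MeasurableSet (Metric.ball (0 : E) 1) := Metric.isOpen_ball.measurableSet
  have hdens := measurable_diffDensity hu₁ hu₂ A₁ A₂
  rw [← lintegral_indicator_one hball,
    ← setLIntegral_tsum_lattice μ h₁₁ h₁₂ h₂₁ h₂₂ hdens.ennreal_ofReal,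
    ← setLIntegral_tsum_lattice μ h₁₁ h₁₂ h₂₁ h₂₂ (measurable_one.indicator hball)]
  refine lintegral_mono fun x => ?_
  set s : ℤ × ℤ → E := fun m => x + ((m.1 : ℝ) • A₁ + (m.2 : ℝ) • A₂) with hs
  have hfin : {m | ‖s m‖ < 1}.Finite := finite_lattice_near h₁₁ h₁₂ h₂₁ h₂₂ x
  have hfin' : ∀ {u : E → ℝ}, (∀ x, 1 ≤ ‖x‖ → u x = 0) →
      (fun m => u (s m)).support.Finite := fun hz =>
    hfin.subset fun m hm => not_le.1 fun h => hm (hz _ h)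
  have e₁ : ∀ m, s (m + (1, 0)) = s m + A₁ := fun m => by
    simp only [hs, Prod.fst_add, Prod.snd_add]; push_cast; module
  have e₂ : ∀ m, s (m + (0, 1)) = s m + A₂ := fun m => by
    simp only [hs, Prod.fst_add, Prod.snd_add]; push_cast; module
  have e₃ : ∀ m, s (m + (-1, 0)) = s m - A₁ := fun m => by
    simp only [hs, Prod.fst_add, Prod.snd_add]; push_cast; module
  have e₄ : ∀ m, s (m + (0, -1)) = s m - A₂ := fun m => by
    simp only [hs, Prod.fst_add, Prod.snd_add]; push_cast; module
  have hdis := tsum_indicator_le (hfin' hz₁) (hfin' hz₂) hfin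
  have hrhs : ∀ m, 7 * (|latticeShear (fun m => u₁ (s m)) (fun m => u₂ (s m)) m|
      + |latticeTwist (fun m => u₁ (s m)) (fun m => u₂ (s m)) m|)
      + {m | ‖s m‖ < 1}.indicator
        (fun m => |(|latticeDiv (fun m => u₁ (s m)) (fun m => u₂ (s m)) m| - 2)|) m
      = diffDensity u₁ u₂ A₁ A₂ (s m) := by
    intro m
    simp only [latticeShear, latticeTwist, latticeDiv, diffDensity, e₁, e₂, e₃, e₄, Set.indicator,
      mem_ball_zero_iff, Set.mem_ofPred_eq]
  have hsum : Summable fun m => diffDensity u₁ u₂ A₁ A₂ (s m) := by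
    refine summable_of_support_finite ?_
    have hf : ∀ t : ℤ × ℤ, {m | ‖s (m + t)‖ < 1}.Finite := fun t =>
      hfin.preimage (add_left_injective t).injOn
    refine (((((hf 0).union (hf (1, 0))).union (hf (0, 1))).union (hf (-1, 0))).union
      (hf (0, -1))).subset fun m hm => ?_
    contrapose! hm
    simp only [Set.mem_union, Set.mem_ofPred_eq, e₁, e₂, e₃, e₄, add_zero, not_or, not_lt] at hm
    obtain ⟨⟨⟨⟨m0, m1⟩, m2⟩, m3⟩, m4⟩ := hm
    simp [diffDensity, hz₁ _ m0, hz₂ _ m0, hz₁ _ m1, hz₂ _ m2, hz₁ _ m4, hz₂ _ m3, Set.indicator,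
      not_lt.2 m0]
  simp only [hrhs] at hdis
  have hlhs : ∀ m, (Metric.ball (0 : E) 1).indicator (1 : E → ENNReal) (s m)
      = ENNReal.ofReal ({m | ‖s m‖ < 1}.indicator (1 : ℤ × ℤ → ℝ) m) := by
    intro m
    by_cases h : ‖s m‖ < 1 <;> simp [Set.indicator, h]
  change ∑' m, (Metric.ball (0 : E) 1).indicator 1 (s m)
    ≤ ∑' m, ENNReal.ofReal (diffDensity u₁ u₂ A₁ A₂ (s m))
  simp only [hlhs]
  rw [← ENNReal.ofReal_tsum_of_nonneg (f := {m | ‖s m‖ < 1}.indicator (1 : ℤ × ℤ → ℝ))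
      (fun m => Set.indicator_nonneg (fun _ _ => zero_le_one) m)
      (summable_of_support_finite (hfin.subset Set.support_indicator_subset)),
    ← ENNReal.ofReal_tsum_of_nonneg (fun m => diffDensity_nonneg _ _ _ _ _) hsum]
  exact ENNReal.ofReal_le_ofReal hdis

end Unfolding

open Matrix in
/-- A real symmetric matrix which is not a symmetrized tensor product is definite on some plane;
in a suitable basis of that plane its quadratic form is plus or minus the identity. -/
lemma exists_plane_of_ne_symTensor {d : ℕ} {F : Matrix (Fin d) (Fin d) ℝ} (hF : F.IsSymm)
    (hFnot : ∀ a b : Fin d → ℝ, F ≠ symTensor a b) :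
    ∃ (s : ℝ) (a b : Fin d → ℝ), s * s = 1 ∧ a ⬝ᵥ F *ᵥ a = s ∧ b ⬝ᵥ F *ᵥ b = s ∧
      a ⬝ᵥ F *ᵥ b = 0 ∧ b ⬝ᵥ F *ᵥ a = 0 := by
  classical
  have hH : F.IsHermitian := by
    rw [Matrix.IsHermitian, Matrix.conjTranspose_eq_transpose_of_trivial]; exact hF
  set l := hH.eigenvalues with hl
  set v : Fin d → Fin d → ℝ := fun k => (hH.eigenvectorBasis k).ofLp with hv
  have hdot : ∀ i j, v i ⬝ᵥ v j = if i = j then 1 else 0 := by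
    intro i j
    have := orthonormal_iff_ite.1 hH.eigenvectorBasis.orthonormal j i
    rw [EuclideanSpace.inner_eq_star_dotProduct] at this
    simpa [hv, eq_comm] using this
  have hmul : ∀ j, F *ᵥ v j = l j • v j := fun j => hH.mulVec_eigenvectorBasis j
  have hquad : ∀ i j, v i ⬝ᵥ F *ᵥ v j = if i = j then l j else 0 := by
    intro i j
    rw [hmul, dotProduct_smul, hdot]
    split_ifs <;> simp
  have hdecomp : ∀ i j, F i j = ∑ k, l k * (v k i * v k j) := by
    intro i j
    conv_lhs => rw [hH.spectral_theorem]
    simp only [Unitary.conjStarAlgAut_apply, Matrix.mul_apply, Matrix.diagonal_apply,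
      Matrix.star_apply]
    simp [hv, hl, Matrix.IsHermitian.eigenvectorUnitary_apply]
    refine Finset.sum_congr rfl fun k _ => by ring
  by_cases hex : ∃ i j, i ≠ j ∧ 0 < l i * l j
  · obtain ⟨i, j, hij, hpos⟩ := hex
    have hi : l i ≠ 0 := left_ne_zero_of_mul hpos.ne'
    have hj : l j ≠ 0 := right_ne_zero_of_mul hpos.ne'
    have hnorm : ∀ k, l k ≠ 0 → (√|l k|)⁻¹ * ((√|l k|)⁻¹ * l k) = SignType.sign (l k) := by
      intro k hk
      rw [← mul_assoc, ← mul_inv, Real.mul_self_sqrt (abs_nonneg _)]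
      rcases lt_or_gt_of_ne hk with h | h
      · rw [abs_of_neg h, sign_neg h]; field_simp; simp
      · rw [abs_of_pos h, sign_pos h]; field_simp; simp
    have hsign : (SignType.sign (l i) : ℝ) = SignType.sign (l j) := by
      rcases pos_and_pos_or_neg_and_neg_of_mul_pos hpos with ⟨h, h'⟩ | ⟨h, h'⟩
      · rw [sign_pos h, sign_pos h']
      · rw [sign_neg h, sign_neg h']
    refine ⟨SignType.sign (l i), (√|l i|)⁻¹ • v i, (√|l j|)⁻¹ • v j, ?_, ?_, ?_, ?_, ?_⟩
    · rcases lt_or_gt_of_ne hi with h | h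
      · simp [sign_neg h]
      · simp [sign_pos h]
    · rw [mulVec_smul, smul_dotProduct, dotProduct_smul, hquad, if_pos rfl, smul_eq_mul,
        smul_eq_mul, hnorm i hi]
    · rw [mulVec_smul, smul_dotProduct, dotProduct_smul, hquad, if_pos rfl, smul_eq_mul,
        smul_eq_mul, hnorm j hj, hsign]
    · rw [mulVec_smul, smul_dotProduct, dotProduct_smul, hquad, if_neg hij]; simp
    · rw [mulVec_smul, smul_dotProduct, dotProduct_smul, hquad, if_neg hij.symm]; simp
  · push Not at hex
    have hrank : ∀ (c : Fin d → ℝ), (∀ k, 0 ≤ c k) → (∀ i j, i ≠ j → c i ≠ 0 → c j = 0) →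
        ∃ a : Fin d → ℝ, ∀ i j, ∑ k, c k * (v k i * v k j) = a i * a j := by
      intro c hc hone
      by_cases hz : ∃ k, c k ≠ 0
      · obtain ⟨k, hk⟩ := hz
        refine ⟨fun i => √(c k) * v k i, fun i j => ?_⟩
        rw [Finset.sum_eq_single k (fun m _ hm => by rw [hone k m hm.symm hk, zero_mul]) (by simp)]
        calc c k * (v k i * v k j) = (√(c k) * √(c k)) * (v k i * v k j) := by
              rw [Real.mul_self_sqrt (hc k)]
          _ = _ := by ring
      · push Not at hz
        exact ⟨0, fun i j => by simp [hz]⟩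
    obtain ⟨a, ha⟩ := hrank (fun k => max (l k) 0) (fun k => le_max_right _ _) (by
      intro i j hij hi
      have h1 : 0 < l i := by
        by_contra h; exact hi (max_eq_right (not_lt.1 h))
      refine max_eq_right ?_
      by_contra! h2
      exact absurd (hex i j hij) (not_le.2 (mul_pos h1 h2)))
    obtain ⟨b, hb⟩ := hrank (fun k => max (-l k) 0) (fun k => le_max_right _ _) (by
      intro i j hij hi
      have h1 : l i < 0 := by
        by_contra h; exact hi (max_eq_right (by linarith))
      refine max_eq_right ?_
      by_contra! h2
      exact absurd (hex i j hij) (not_le.2 (mul_pos_of_neg_of_neg h1 (by linarith))))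
    refine absurd ?_ (hFnot (a + b) (a - b))
    ext i j
    have hsplit : ∀ r : ℝ, r = max r 0 - max (-r) 0 := fun r => by
      rcases le_total 0 r with h | h
      · rw [max_eq_left h, max_eq_right (by linarith)]; ring
      · rw [max_eq_right h, max_eq_left (by linarith)]; ring
    rw [hdecomp]
    calc ∑ k, l k * (v k i * v k j)
        = ∑ k, (max (l k) 0 * (v k i * v k j) - max (-l k) 0 * (v k i * v k j)) :=
          Finset.sum_congr rfl fun k _ => by rw [← sub_mul, ← hsplit]
      _ = a i * a j - b i * b j := by rw [Finset.sum_sub_distrib, ha, hb]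
      _ = symTensor (a + b) (a - b) i j := by
          simp only [symTensor, Pi.add_apply, Pi.sub_apply]; ring

section Limit

open Filter Topology
open scoped NNReal

variable {E : Type*} [NormedAddCommGroup E] [NormedSpace ℝ E]

/-- The infinitesimal counterpart of `diffDensity`. -/
noncomputable def derivDensity (u₁ u₂ : E → ℝ) (a₁ a₂ x : E) : ℝ :=
  7 * (|fderiv ℝ u₁ x a₁ - fderiv ℝ u₂ x a₂| + |fderiv ℝ u₁ x a₂ + fderiv ℝ u₂ x a₁|)
    + (Metric.ball (0 : E) 1).indicator
      (fun x => |(|fderiv ℝ u₁ x a₁ + fderiv ℝ u₂ x a₂| - 2)|) x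

lemma diffDensity_scaled (u₁ u₂ : E → ℝ) (a₁ a₂ x : E) (t : ℝ) :
    diffDensity (fun x => t⁻¹ * u₁ x) (fun x => t⁻¹ * u₂ x) (t • a₁) (t • a₂) x =
      7 * (|t⁻¹ * (u₁ (x + t • a₁) - u₁ x) - t⁻¹ * (u₂ (x + t • a₂) - u₂ x)|
        + |(-t)⁻¹ * (u₁ (x + (-t) • a₂) - u₁ x) + (-t)⁻¹ * (u₂ (x + (-t) • a₁) - u₂ x)|)
      + (Metric.ball (0 : E) 1).indicator
        (fun x => |(|t⁻¹ * (u₁ (x + t • a₁) - u₁ x) + t⁻¹ * (u₂ (x + t • a₂) - u₂ x)| - 2)|) x := by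
  simp only [diffDensity, neg_smul, ← sub_eq_add_neg, inv_neg, mul_sub]
  congr 4
  ring

lemma LipschitzWith.abs_difference_quotient_le {K : ℝ≥0} {u : E → ℝ} (hu : LipschitzWith K u)
    (a x : E) (t : ℝ) : |t⁻¹ * (u (x + t • a) - u x)| ≤ K * ‖a‖ := by
  rcases eq_or_ne t 0 with rfl | ht
  · simp; positivity
  have h := hu.dist_le_mul (x + t • a) x
  rw [Real.dist_eq, dist_eq_norm, add_sub_cancel_left, norm_smul, Real.norm_eq_abs] at h
  rw [abs_mul, abs_inv, inv_mul_le_iff₀ (abs_pos.2 ht)]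
  linarith

lemma tendsto_diffDensity {u₁ u₂ : E → ℝ} {a₁ a₂ x : E} (h₁ : DifferentiableAt ℝ u₁ x)
    (h₂ : DifferentiableAt ℝ u₂ x) :
    Tendsto (fun t : ℝ =>
        diffDensity (fun x => t⁻¹ * u₁ x) (fun x => t⁻¹ * u₂ x) (t • a₁) (t • a₂) x)
      (𝓝[≠] 0) (𝓝 (derivDensity u₁ u₂ a₁ a₂ x)) := by
  have hq : ∀ {u : E → ℝ}, DifferentiableAt ℝ u x → ∀ a : E,
      Tendsto (fun t : ℝ => t⁻¹ * (u (x + t • a) - u x)) (𝓝[≠] 0) (𝓝 (fderiv ℝ u x a)) :=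
    fun hu a => (hu.hasFDerivAt.hasLineDerivAt a).tendsto_slope_zero
  have hneg : Tendsto (fun t : ℝ => -t) (𝓝[≠] 0) (𝓝[≠] 0) := by
    refine tendsto_nhdsWithin_iff.2 ⟨?_, ?_⟩
    · simpa using (tendsto_id.neg : Tendsto (fun t : ℝ => -t) (𝓝 0) (𝓝 (-0))).mono_left
        nhdsWithin_le_nhds
    · filter_upwards [self_mem_nhdsWithin] with t ht
      simpa using ht
  simp only [diffDensity_scaled, derivDensity]
  refine Tendsto.add (Tendsto.const_mul _ (Tendsto.add ?_ ?_)) ?_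
  · exact ((hq h₁ a₁).sub (hq h₂ a₂)).abs
  · exact (((hq h₁ a₂).comp hneg).add ((hq h₂ a₁).comp hneg)).abs
  · by_cases hx : x ∈ Metric.ball (0 : E) 1
    · simp only [Set.indicator_of_mem hx]
      exact ((((hq h₁ a₁).add (hq h₂ a₂)).abs).sub_const 2).abs
    · simp only [Set.indicator_of_notMem hx]
      exact tendsto_const_nhds

lemma diffDensity_scaled_le {K : ℝ≥0} {u₁ u₂ : E → ℝ} (hu₁ : LipschitzWith K u₁)
    (hu₂ : LipschitzWith K u₂) (hz₁ : ∀ x, 1 ≤ ‖x‖ → u₁ x = 0) (hz₂ : ∀ x, 1 ≤ ‖x‖ → u₂ x = 0)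
    (a₁ a₂ x : E) {t : ℝ} (ht : |t| ≤ 1) :
    diffDensity (fun x => t⁻¹ * u₁ x) (fun x => t⁻¹ * u₂ x) (t • a₁) (t • a₂) x ≤
      (Metric.ball (0 : E) (1 + ‖a₁‖ + ‖a₂‖)).indicator
        (fun _ => 15 * (K * ‖a₁‖ + K * ‖a₂‖) + 2) x := by
  by_cases hx : x ∈ Metric.ball (0 : E) (1 + ‖a₁‖ + ‖a₂‖)
  · rw [Set.indicator_of_mem hx, diffDensity_scaled]
    have b₁ := hu₁.abs_difference_quotient_le a₁ x t
    have b₂ := hu₂.abs_difference_quotient_le a₂ x t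
    have b₃ := hu₁.abs_difference_quotient_le a₂ x (-t)
    have b₄ := hu₂.abs_difference_quotient_le a₁ x (-t)
    have c₁ := abs_sub (t⁻¹ * (u₁ (x + t • a₁) - u₁ x)) (t⁻¹ * (u₂ (x + t • a₂) - u₂ x))
    have c₂ := abs_add_le ((-t)⁻¹ * (u₁ (x + (-t) • a₂) - u₁ x))
      ((-t)⁻¹ * (u₂ (x + (-t) • a₁) - u₂ x))
    have c₃ := abs_add_le (t⁻¹ * (u₁ (x + t • a₁) - u₁ x)) (t⁻¹ * (u₂ (x + t • a₂) - u₂ x))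
    have c₄ : (Metric.ball (0 : E) 1).indicator
        (fun x => |(|t⁻¹ * (u₁ (x + t • a₁) - u₁ x) + t⁻¹ * (u₂ (x + t • a₂) - u₂ x)| - 2)|) x
        ≤ |t⁻¹ * (u₁ (x + t • a₁) - u₁ x) + t⁻¹ * (u₂ (x + t • a₂) - u₂ x)| + 2 := by
      refine (Set.indicator_le_self' (fun _ _ => abs_nonneg _) x).trans ?_
      refine (abs_sub _ _).trans (by simp)
    linarith
  · have hx' : 1 + ‖a₁‖ + ‖a₂‖ ≤ ‖x‖ := by simpa using hx
    have far : ∀ (a : E) (r : ℝ), |r| ≤ 1 → ‖a‖ ≤ ‖a₁‖ + ‖a₂‖ → 1 ≤ ‖x + r • a‖ := by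
      intro a r hr ha
      have h1 := norm_sub_norm_le x (-(r • a))
      rw [norm_neg, sub_neg_eq_add, norm_smul, Real.norm_eq_abs] at h1
      nlinarith [norm_nonneg a]
    have ht' : |-t| ≤ 1 := by rwa [abs_neg]
    have n₁ : ‖a₁‖ ≤ ‖a₁‖ + ‖a₂‖ := by simp
    have n₂ : ‖a₂‖ ≤ ‖a₁‖ + ‖a₂‖ := by simp
    have n₀ : 1 ≤ ‖x‖ := by linarith [norm_nonneg a₁, norm_nonneg a₂]
    have hb : x ∉ Metric.ball (0 : E) 1 := by simpa using n₀
    rw [Set.indicator_of_notMem hx, diffDensity_scaled, Set.indicator_of_notMem hb,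
      hz₁ _ (far a₁ t ht n₁), hz₂ _ (far a₂ t ht n₂), hz₁ _ (far a₂ (-t) ht' n₂),
      hz₂ _ (far a₁ (-t) ht' n₁), hz₁ x n₀, hz₂ x n₀]
    simp

lemma derivDensity_eq_zero {u₁ u₂ : E → ℝ} (hz₁ : ∀ x, 1 ≤ ‖x‖ → u₁ x = 0)
    (hz₂ : ∀ x, 1 ≤ ‖x‖ → u₂ x = 0) (a₁ a₂ : E) {x : E} (hx : 1 < ‖x‖) :
    derivDensity u₁ u₂ a₁ a₂ x = 0 := by
  have key : ∀ {u : E → ℝ}, (∀ x, 1 ≤ ‖x‖ → u x = 0) → fderiv ℝ u x = 0 := by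
    intro u hz
    have h : u =ᶠ[𝓝 x] fun _ => 0 := by
      filter_upwards [continuous_norm.continuousAt.eventually (lt_mem_nhds hx)] with y hy
      exact hz y hy.le
    rw [h.fderiv_eq]; simp
  have hb : x ∉ Metric.ball (0 : E) 1 := by simpa using hx.le
  simp [derivDensity, key hz₁, key hz₂, Set.indicator_of_notMem hb]

variable [FiniteDimensional ℝ E] [MeasurableSpace E] [BorelSpace E]

lemma measure_ball_le_lintegral_derivDensity (μ : Measure E) [μ.IsAddHaarMeasure] {a₁ a₂ : E}
    {l₁ l₂ : E →L[ℝ] ℝ} (h₁₁ : l₁ a₁ = 1) (h₁₂ : l₁ a₂ = 0) (h₂₁ : l₂ a₁ = 0) (h₂₂ : l₂ a₂ = 1)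
    {K : ℝ≥0} {u₁ u₂ : E → ℝ} (hu₁ : LipschitzWith K u₁) (hu₂ : LipschitzWith K u₂)
    (hz₁ : ∀ x, 1 ≤ ‖x‖ → u₁ x = 0) (hz₂ : ∀ x, 1 ≤ ‖x‖ → u₂ x = 0) :
    μ (Metric.ball 0 1) ≤ ∫⁻ x, ENNReal.ofReal (derivDensity u₁ u₂ a₁ a₂ x) ∂μ := by
  have ht0 : ∀ n : ℕ, (1 / ((n : ℝ) + 1)) ≠ 0 := fun n => by positivity
  have ht1 : ∀ n : ℕ, |(1 / ((n : ℝ) + 1))| ≤ 1 := fun n => by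
    rw [abs_of_nonneg (by positivity), div_le_one (by positivity)]
    linarith [n.cast_nonneg (α := ℝ)]
  have hlim : Tendsto (fun n : ℕ => 1 / ((n : ℝ) + 1)) atTop (𝓝[≠] 0) :=
    tendsto_nhdsWithin_iff.2 ⟨tendsto_one_div_add_atTop_nhds_zero_nat, .of_forall ht0⟩
  refine ge_of_tendsto' (tendsto_lintegral_of_dominated_convergence
    (F := fun (n : ℕ) x => ENNReal.ofReal (diffDensity (fun x => (1 / ((n : ℝ) + 1))⁻¹ * u₁ x)
      (fun x => (1 / ((n : ℝ) + 1))⁻¹ * u₂ x) ((1 / ((n : ℝ) + 1)) • a₁)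
      ((1 / ((n : ℝ) + 1)) • a₂) x))
    (fun x => ENNReal.ofReal ((Metric.ball (0 : E) (1 + ‖a₁‖ + ‖a₂‖)).indicator
        (fun _ => 15 * (K * ‖a₁‖ + K * ‖a₂‖) + 2) x)) ?_ ?_ ?_ ?_) fun n => ?_
  · exact fun n => (measurable_diffDensity (hu₁.continuous.const_mul _)
      (hu₂.continuous.const_mul _) _ _).ennreal_ofReal
  · exact fun n => .of_forall fun x =>
      ENNReal.ofReal_le_ofReal (diffDensity_scaled_le hu₁ hu₂ hz₁ hz₂ a₁ a₂ x (ht1 n))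
  · exact (Integrable.lintegral_lt_top (IntegrableOn.integrable_indicator
      (integrableOn_const measure_ball_lt_top.ne)
      Metric.isOpen_ball.measurableSet)).ne
  · filter_upwards [hu₁.ae_differentiableAt, hu₂.ae_differentiableAt] with x h₁ h₂
    exact ENNReal.tendsto_ofReal ((tendsto_diffDensity h₁ h₂).comp hlim)
  · have hn := ht0 n
    refine measure_ball_le_lintegral μ (l₁ := (1 / ((n : ℝ) + 1))⁻¹ • l₁)
      (l₂ := (1 / ((n : ℝ) + 1))⁻¹ • l₂) ?_ ?_ ?_ ?_ (hu₁.continuous.const_mul _)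
      (hu₂.continuous.const_mul _) (fun x hx => by simp [hz₁ x hx]) (fun x hx => by simp [hz₂ x hx])
    · simp only [smul_apply, map_smul, h₁₁, smul_eq_mul]; field_simp
    · simp [h₁₂]
    · simp [h₂₁]
    · simp only [smul_apply, map_smul, h₂₂, smul_eq_mul]; field_simp

end Limit

section TwoWell

open Matrix
open scoped NNReal

lemma frob_nonneg {d : ℕ} (M : Matrix (Fin d) (Fin d) ℝ) : 0 ≤ frob M := Real.sqrt_nonneg _

lemma abs_entry_le_frob {d : ℕ} (M : Matrix (Fin d) (Fin d) ℝ) (i j : Fin d) :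
    |M i j| ≤ frob M := by
  refine Real.abs_le_sqrt ?_
  refine (Finset.single_le_sum (f := fun j => M i j ^ 2) (fun _ _ => sq_nonneg _)
    (Finset.mem_univ j)).trans ?_
  exact Finset.single_le_sum (f := fun i => ∑ j, M i j ^ 2)
    (fun _ _ => Finset.sum_nonneg fun _ _ => sq_nonneg _) (Finset.mem_univ i)

lemma frob_le_of_abs_le {d : ℕ} {M : Matrix (Fin d) (Fin d) ℝ} {C : ℝ} (hC : 0 ≤ C)
    (h : ∀ i j, |M i j| ≤ C) : frob M ≤ d * C := by
  refine Real.sqrt_le_iff.2 ⟨by positivity, ?_⟩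
  calc ∑ i, ∑ j, M i j ^ 2 ≤ ∑ _i : Fin d, ∑ _j : Fin d, C ^ 2 := by
        refine Finset.sum_le_sum fun i _ => Finset.sum_le_sum fun j _ => sq_le_sq.2 ?_
        rw [abs_of_nonneg hC]
        exact h i j
    _ = (d * C) ^ 2 := by simp; ring

lemma abs_dotProduct_mulVec_le {d : ℕ} (M : Matrix (Fin d) (Fin d) ℝ) (a b : Fin d → ℝ) :
    |a ⬝ᵥ M *ᵥ b| ≤ (∑ i, |a i|) * (∑ j, |b j|) * frob M := by
  calc |a ⬝ᵥ M *ᵥ b| ≤ ∑ i, |a i| * ∑ j, |M i j| * |b j| := by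
        refine (Finset.abs_sum_le_sum_abs (fun i => a i * (M *ᵥ b) i) _).trans
          (Finset.sum_le_sum fun i _ => ?_)
        rw [abs_mul]
        gcongr
        change |∑ j, M i j * b j| ≤ _
        refine (Finset.abs_sum_le_sum_abs _ _).trans_eq ?_
        simp only [abs_mul]
    _ ≤ ∑ i, |a i| * ∑ j, frob M * |b j| := by
        gcongr with i _ j _
        exact abs_entry_le_frob M i j
    _ = (∑ i, |a i|) * (∑ j, |b j|) * frob M := by
        rw [← Finset.sum_mul, ← Finset.mul_sum]; ring

/-- Shear, twist and divergence of a gradient `G` in the frame `a, b` are controlled by the distance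
of the symmetric part of `G` to the wells. -/
lemma gradient_terms_le {d : ℕ} {F G M : Matrix (Fin d) (Fin d) ℝ} {s σ : ℝ} (hs : s * s = 1)
    (hσ : σ * σ = 1) {a b : Fin d → ℝ} (haa : a ⬝ᵥ F *ᵥ a = s) (hbb : b ⬝ᵥ F *ᵥ b = s)
    (hab : a ⬝ᵥ F *ᵥ b = 0) (hM : M + M = G + Gᵀ) :
    7 * (|a ⬝ᵥ G *ᵥ a - b ⬝ᵥ G *ᵥ b| + |a ⬝ᵥ G *ᵥ b + b ⬝ᵥ G *ᵥ a|)
      + |(|a ⬝ᵥ G *ᵥ a + b ⬝ᵥ G *ᵥ b| - 2)|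
      ≤ 30 * (∑ i, |a i| + ∑ i, |b i|) ^ 2 * frob (M - σ • F) := by
  have htr : ∀ v w : Fin d → ℝ, v ⬝ᵥ Gᵀ *ᵥ w = w ⬝ᵥ G *ᵥ v := fun v w => by
    rw [mulVec_transpose, dotProduct_comm, ← dotProduct_mulVec]
  have hpol : ∀ v w : Fin d → ℝ, 2 * (v ⬝ᵥ (M - σ • F) *ᵥ w)
      = v ⬝ᵥ G *ᵥ w + w ⬝ᵥ G *ᵥ v - 2 * σ * (v ⬝ᵥ F *ᵥ w) := fun v w => by
    have h : v ⬝ᵥ (M + M) *ᵥ w = v ⬝ᵥ G *ᵥ w + w ⬝ᵥ G *ᵥ v := by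
      rw [hM, add_mulVec, dotProduct_add, htr]
    rw [add_mulVec, dotProduct_add] at h
    rw [sub_mulVec, dotProduct_sub, smul_mulVec, dotProduct_smul, smul_eq_mul]
    linarith
  set f := frob (M - σ • F)
  set A := ∑ i, |a i|
  set B := ∑ i, |b i|
  have hf : 0 ≤ f := frob_nonneg _
  have hA : 0 ≤ A := Finset.sum_nonneg fun _ _ => abs_nonneg _
  have hB : 0 ≤ B := Finset.sum_nonneg fun _ _ => abs_nonneg _
  have haa' := hpol a a
  have hbb' := hpol b b
  have hab' := hpol a b
  rw [haa] at haa'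
  rw [hbb] at hbb'
  rw [hab] at hab'
  have b₁ : |a ⬝ᵥ (M - σ • F) *ᵥ a| ≤ (A + B) ^ 2 * f :=
    (abs_dotProduct_mulVec_le _ a a).trans (by gcongr; nlinarith)
  have b₂ : |b ⬝ᵥ (M - σ • F) *ᵥ b| ≤ (A + B) ^ 2 * f :=
    (abs_dotProduct_mulVec_le _ b b).trans (by gcongr; nlinarith)
  have b₃ : |a ⬝ᵥ (M - σ • F) *ᵥ b| ≤ (A + B) ^ 2 * f :=
    (abs_dotProduct_mulVec_le _ a b).trans (by gcongr; nlinarith)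
  generalize a ⬝ᵥ (M - σ • F) *ᵥ a = x at *
  generalize b ⬝ᵥ (M - σ • F) *ᵥ b = y at *
  generalize a ⬝ᵥ (M - σ • F) *ᵥ b = z at *
  have e₁ : a ⬝ᵥ G *ᵥ a - b ⬝ᵥ G *ᵥ b = x - y := by linarith
  have e₂ : a ⬝ᵥ G *ᵥ b + b ⬝ᵥ G *ᵥ a = 2 * z := by linarith
  have e₃ : a ⬝ᵥ G *ᵥ a + b ⬝ᵥ G *ᵥ b = 2 * (σ * s) + (x + y) := by linarith
  have e₄ : (2 : ℝ) = |2 * (σ * s)| := by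
    have h : |σ * s| = 1 := by
      have : (σ * s) * (σ * s) = 1 := by linear_combination s * s * hσ + hs
      rcases mul_self_eq_one_iff.1 this with h | h <;> simp [h]
    rw [abs_mul, h]; norm_num
  have c₃ : |(|2 * (σ * s) + (x + y)| - 2)| ≤ |x + y| := by
    nth_rewrite 2 [e₄]
    refine (abs_abs_sub_abs_le _ _).trans_eq ?_
    congr 1; ring
  rw [e₁, e₂, e₃, abs_mul, abs_two]
  have c₁ := abs_sub x y
  have c₂ := abs_add_le x y
  linarith

/-- The distance of the symmetrized gradient to the two wells. -/
noncomputable def wellDist {d : ℕ} (F : Matrix (Fin d) (Fin d) ℝ)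
    (ψ : EuclideanSpace ℝ (Fin d) → EuclideanSpace ℝ (Fin d)) (x : EuclideanSpace ℝ (Fin d)) : ℝ :=
  min (frob (symGradE ψ x + F)) (frob (symGradE ψ x - F))

variable {d : ℕ} {F : Matrix (Fin d) (Fin d) ℝ}
  {ψ : EuclideanSpace ℝ (Fin d) → EuclideanSpace ℝ (Fin d)} {K : ℝ≥0}

lemma wellDist_nonneg (x : EuclideanSpace ℝ (Fin d)) : 0 ≤ wellDist F ψ x :=
  le_min (frob_nonneg _) (frob_nonneg _)

lemma measurable_wellDist : Measurable (wellDist F ψ) := by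
  have hG : ∀ i j, Measurable fun x => symGradE ψ x i j := fun i j => by
    have h : ∀ k l : Fin d, Measurable fun x => fderiv ℝ ψ x (EuclideanSpace.single l 1) k :=
      fun k l => by
        have h1 := measurable_fderiv_apply_const ℝ ψ (EuclideanSpace.single l (1 : ℝ))
        exact (EuclideanSpace.proj (𝕜 := ℝ) k).continuous.measurable.comp h1
    exact ((h i j).add (h j i)).div_const 2
  refine Measurable.min ?_ ?_
  · exact (Finset.measurable_sum _ fun i _ => Finset.measurable_sum _ fun j _ =>
      ((hG i j).add_const _).pow_const 2).sqrt
  · exact (Finset.measurable_sum _ fun i _ => Finset.measurable_sum _ fun j _ =>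
      ((hG i j).sub_const _).pow_const 2).sqrt

lemma wellDist_le (hψ : LipschitzWith K ψ) (x : EuclideanSpace ℝ (Fin d)) :
    wellDist F ψ x ≤ d * (K + frob F) := by
  refine (min_le_left _ _).trans (frob_le_of_abs_le (add_nonneg K.2 (frob_nonneg _)) fun i j => ?_)
  have h : ∀ k l : Fin d, |fderiv ℝ ψ x (EuclideanSpace.single l 1) k| ≤ K := fun k l => by
    calc |fderiv ℝ ψ x (EuclideanSpace.single l 1) k|
        ≤ ‖fderiv ℝ ψ x (EuclideanSpace.single l 1)‖ :=
          PiLp.norm_apply_le (fderiv ℝ ψ x (EuclideanSpace.single l 1)) k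
      _ ≤ ‖fderiv ℝ ψ x‖ * ‖EuclideanSpace.single l (1 : ℝ)‖ := ContinuousLinearMap.le_opNorm _ _
      _ ≤ K := by simpa using norm_fderiv_le_of_lipschitz ℝ hψ
  have h1 := abs_le.1 (h i j)
  have h2 := abs_le.1 (h j i)
  have h3 := abs_le.1 (abs_entry_le_frob F i j)
  change |(fderiv ℝ ψ x (EuclideanSpace.single j 1) i
    + fderiv ℝ ψ x (EuclideanSpace.single i 1) j) / 2 + F i j| ≤ K + frob F
  refine abs_le.2 ⟨?_, ?_⟩ <;> linarith

lemma derivDensity_le_wellDist {s : ℝ} (hs : s * s = 1) {a b : Fin d → ℝ}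
    (haa : a ⬝ᵥ F *ᵥ a = s) (hbb : b ⬝ᵥ F *ᵥ b = s) (hab : a ⬝ᵥ F *ᵥ b = 0)
    {x : EuclideanSpace ℝ (Fin d)} (hψ : DifferentiableAt ℝ ψ x) :
    derivDensity (fun x => innerSL ℝ (WithLp.toLp 2 a) (ψ x))
      (fun x => innerSL ℝ (WithLp.toLp 2 b) (ψ x)) (WithLp.toLp 2 a) (WithLp.toLp 2 b) x
      ≤ 30 * (∑ i, |a i| + ∑ i, |b i|) ^ 2 * wellDist F ψ x := by
  set G : Matrix (Fin d) (Fin d) ℝ := fun k l => fderiv ℝ ψ x (EuclideanSpace.single l 1) k with hG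
  have hfd : ∀ v w : Fin d → ℝ, fderiv ℝ (fun x => innerSL ℝ (WithLp.toLp 2 v) (ψ x)) x
      (WithLp.toLp 2 w) = v ⬝ᵥ G *ᵥ w := by
    intro v w
    have h1 := ((innerSL ℝ (WithLp.toLp 2 v)).hasFDerivAt.comp x hψ.hasFDerivAt).fderiv
    have h2 : (WithLp.toLp 2 w : EuclideanSpace ℝ (Fin d))
        = ∑ l, w l • EuclideanSpace.single l (1 : ℝ) := by
      ext k; simp [Pi.single_apply]
    have h3 : ∀ k, fderiv ℝ ψ x (WithLp.toLp 2 w) k = (G *ᵥ w) k := by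
      intro k
      rw [h2, map_sum]
      simp [hG, mulVec, dotProduct, mul_comm]
    change fderiv ℝ (innerSL ℝ (WithLp.toLp 2 v) ∘ ψ) x _ = _
    rw [h1]
    simp [PiLp.inner_apply, dotProduct, h3, mul_comm]
  have hM : symGradE ψ x + symGradE ψ x = G + Gᵀ := by
    ext i j
    change symGradE ψ x i j + symGradE ψ x i j = G i j + G j i
    simp only [symGradE, hG]
    ring
  have hle : derivDensity (fun x => innerSL ℝ (WithLp.toLp 2 a) (ψ x))
      (fun x => innerSL ℝ (WithLp.toLp 2 b) (ψ x)) (WithLp.toLp 2 a) (WithLp.toLp 2 b) x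
      ≤ 7 * (|a ⬝ᵥ G *ᵥ a - b ⬝ᵥ G *ᵥ b| + |a ⬝ᵥ G *ᵥ b + b ⬝ᵥ G *ᵥ a|)
        + |(|a ⬝ᵥ G *ᵥ a + b ⬝ᵥ G *ᵥ b| - 2)| := by
    simp only [derivDensity, ← hfd]
    gcongr
    exact Set.indicator_le_self' (fun _ _ => abs_nonneg _) x
  refine hle.trans ?_
  rcases min_choice (frob (symGradE ψ x + F)) (frob (symGradE ψ x - F)) with h | h
  · have := gradient_terms_le hs (σ := -1) (by norm_num) haa hbb hab hM
    rwa [neg_one_smul, sub_neg_eq_add, ← h] at this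
  · have := gradient_terms_le hs (σ := 1) (by norm_num) haa hbb hab hM
    rwa [one_smul, ← h] at this

lemma integrableOn_ball_of_bounded {E : Type*} [NormedAddCommGroup E] [MeasurableSpace E]
    {μ : Measure E} (hμ : μ (Metric.ball 0 1) < ⊤) {f : E → ℝ} (hf : Measurable f) {C : ℝ}
    (hC : ∀ x, |f x| ≤ C) : IntegrableOn f (Metric.ball 0 1) μ :=
  Measure.integrableOn_of_bounded hμ.ne hf.aestronglyMeasurable (.of_forall hC)

/-- The mean distance of the symmetrized gradient to the wells is bounded below. -/
lemma one_le_mul_setAverage_wellDist {s : ℝ} (hs : s * s = 1) {a b : Fin d → ℝ}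
    (haa : a ⬝ᵥ F *ᵥ a = s) (hbb : b ⬝ᵥ F *ᵥ b = s) (hab : a ⬝ᵥ F *ᵥ b = 0)
    (hba : b ⬝ᵥ F *ᵥ a = 0) (hψ : LipschitzWith K ψ) (hz : ∀ x, 1 ≤ ‖x‖ → ψ x = 0) :
    1 ≤ 30 * (∑ i, |a i| + ∑ i, |b i|) ^ 2 * ⨍ x in Metric.ball 0 1, wellDist F ψ x := by
  set C := 30 * (∑ i, |a i| + ∑ i, |b i|) ^ 2
  set u : (Fin d → ℝ) → EuclideanSpace ℝ (Fin d) → ℝ :=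
    fun v x => innerSL ℝ (WithLp.toLp 2 v) (ψ x) with hu
  have hB : MeasurableSet (Metric.ball (0 : EuclideanSpace ℝ (Fin d)) 1) :=
    Metric.isOpen_ball.measurableSet
  have hlip : ∀ v : Fin d → ℝ, LipschitzWith (‖innerSL ℝ
      (WithLp.toLp 2 v : EuclideanSpace ℝ (Fin d))‖₊ * K) (u v) := fun v =>
    (innerSL ℝ (WithLp.toLp 2 v)).lipschitz.comp hψ
  have huz : ∀ v x, 1 ≤ ‖x‖ → u v x = 0 := fun v x hx => by simp [hu, hz x hx]
  have hl : ∀ v w : Fin d → ℝ, innerSL ℝ (WithLp.toLp 2 (s • (v ᵥ* F)) :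
      EuclideanSpace ℝ (Fin d)) (WithLp.toLp 2 w) = s * (v ⬝ᵥ F *ᵥ w) := fun v w => by
    rw [innerSL_apply_apply, EuclideanSpace.inner_toLp_toLp, dotProduct_mulVec]
    simp [dotProduct_comm w]
  have h1 := measure_ball_le_lintegral_derivDensity volume
    (a₁ := (WithLp.toLp 2 a : EuclideanSpace ℝ (Fin d))) (a₂ := WithLp.toLp 2 b)
    (l₁ := innerSL ℝ (WithLp.toLp 2 (s • (a ᵥ* F))))
    (l₂ := innerSL ℝ (WithLp.toLp 2 (s • (b ᵥ* F))))
    (by rw [hl, haa, hs]) (by rw [hl, hab, mul_zero]) (by rw [hl, hba, mul_zero])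
    (by rw [hl, hbb, hs]) ((hlip a).weaken (le_max_left _ _)) ((hlip b).weaken (le_max_right _ _))
    (huz a) (huz b)
  have hw_int : IntegrableOn (wellDist F ψ) (Metric.ball 0 1) :=
    integrableOn_ball_of_bounded measure_ball_lt_top measurable_wellDist fun x => by
      rw [abs_of_nonneg (wellDist_nonneg x)]
      exact wellDist_le hψ x
  have h2 : ∫⁻ x, ENNReal.ofReal (derivDensity (u a) (u b) (WithLp.toLp 2 a) (WithLp.toLp 2 b) x)
      ≤ ∫⁻ x, (Metric.ball 0 1).indicator (fun x => ENNReal.ofReal (C * wellDist F ψ x)) x := by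
    have hsph : ∀ᵐ x : EuclideanSpace ℝ (Fin d), x ∉ Metric.sphere 0 1 :=
      measure_eq_zero_iff_ae_notMem.1 (Measure.addHaar_sphere_of_ne_zero _ _ one_ne_zero)
    refine lintegral_mono_ae ?_
    filter_upwards [hψ.ae_differentiableAt, hsph] with x hx hx1
    by_cases hxB : x ∈ Metric.ball 0 1
    · rw [Set.indicator_of_mem hxB]
      exact ENNReal.ofReal_le_ofReal (derivDensity_le_wellDist hs haa hbb hab hx)
    · rw [derivDensity_eq_zero (huz a) (huz b)]
      · simp
      · rw [mem_sphere_zero_iff_norm] at hx1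
        rw [mem_ball_zero_iff, not_lt] at hxB
        exact lt_of_le_of_ne hxB (Ne.symm hx1)
  rw [lintegral_indicator hB, ← ofReal_integral_eq_lintegral_ofReal (hw_int.const_mul C)
    (.of_forall fun x => mul_nonneg (by positivity) (wellDist_nonneg x)),
    integral_const_mul] at h2
  have hpos : 0 < volume.real (Metric.ball (0 : EuclideanSpace ℝ (Fin d)) 1) :=
    ENNReal.toReal_pos (Metric.measure_ball_pos _ _ one_pos).ne' measure_ball_lt_top.ne
  have h3 : volume.real (Metric.ball (0 : EuclideanSpace ℝ (Fin d)) 1)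
      ≤ C * ∫ x in Metric.ball 0 1, wellDist F ψ x :=
    ENNReal.toReal_le_of_le_ofReal (mul_nonneg (by positivity)
      (integral_nonneg fun x => wellDist_nonneg x)) (h1.trans h2)
  rw [setAverage_eq, smul_eq_mul]
  calc (1 : ℝ) ≤ (C * ∫ x in Metric.ball 0 1, wellDist F ψ x)
        / volume.real (Metric.ball (0 : EuclideanSpace ℝ (Fin d)) 1) := by
        rwa [le_div_iff₀ hpos, one_mul]
    _ = _ := by ring

end TwoWell

/-- If the symmetric matrix `F` is not a symmetric tensor product `a ⊙ b`, then there is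
`c > 0` such that for every Lipschitz `ψ` vanishing outside the unit ball,
`⨍_{B₁} dist(𝓔ψ, {−F, F})^p ≥ c`; in particular, the symmetric-quasiconvex envelope of
`A ↦ dist(A, {−F,F})^p` is strictly positive at `0`, hence not convex. -/
theorem two_well_positivity {d : ℕ} (hd : 2 ≤ d) (p : ℝ) (hp : 1 ≤ p)
    (F : Matrix (Fin d) (Fin d) ℝ) (hF : F.IsSymm)
    (hFnot : ∀ a b : Fin d → ℝ, F ≠ symTensor a b) :
    ∃ c > 0, ∀ ψ : EuclideanSpace ℝ (Fin d) → EuclideanSpace ℝ (Fin d),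
      (∃ K, LipschitzWith K ψ) → (∀ x, 1 ≤ ‖x‖ → ψ x = 0) →
      c ≤ ⨍ x in Metric.ball (0 : EuclideanSpace ℝ (Fin d)) 1,
            (min (frob (symGradE ψ x + F)) (frob (symGradE ψ x - F))) ^ p := by
  obtain ⟨s, a, b, hs, haa, hbb, hab, hba⟩ := exists_plane_of_ne_symTensor hF hFnot
  set C := 30 * (∑ i, |a i| + ∑ i, |b i|) ^ 2
  have hC0 : 0 ≤ C := by positivity
  refine ⟨(C + 1)⁻¹ ^ p, by positivity, ?_⟩
  rintro ψ ⟨K, hψ⟩ hz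
  have hav := one_le_mul_setAverage_wellDist hs haa hbb hab hba hψ hz
  have hw := wellDist_le (F := F) hψ
  have havg : 0 ≤ ⨍ x in Metric.ball 0 1, wellDist F ψ x := by
    rw [setAverage_eq]
    exact smul_nonneg (by positivity) (integral_nonneg fun x => wellDist_nonneg x)
  have hw_int : IntegrableOn (wellDist F ψ) (Metric.ball 0 1) :=
    integrableOn_ball_of_bounded measure_ball_lt_top measurable_wellDist fun x => by
      rw [abs_of_nonneg (wellDist_nonneg x)]
      exact hw x
  have hwp_int : IntegrableOn (fun x => wellDist F ψ x ^ p) (Metric.ball 0 1) :=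
    integrableOn_ball_of_bounded measure_ball_lt_top (measurable_wellDist.pow_const p) fun x => by
      rw [abs_of_nonneg (Real.rpow_nonneg (wellDist_nonneg x) p)]
      exact Real.rpow_le_rpow (wellDist_nonneg x) (hw x) (by linarith)
  calc (C + 1)⁻¹ ^ p ≤ (⨍ x in Metric.ball 0 1, wellDist F ψ x) ^ p := by
        refine Real.rpow_le_rpow (by positivity) ?_ (by linarith)
        rw [inv_le_iff_one_le_mul₀' (by positivity)]
        linarith
    _ ≤ ⨍ x in Metric.ball 0 1, wellDist F ψ x ^ p :=
        (convexOn_rpow hp).map_set_average_le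
          (Real.continuous_rpow_const (by linarith)).continuousOn isClosed_Ici
          (Metric.measure_ball_pos _ _ one_pos).ne' measure_ball_lt_top.ne
          (.of_forall fun x => wellDist_nonneg x) hw_int hwp_int
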